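/- The Gauss curvature of the meridian surface M², given by K = ⟨h(x,x), h(y,y)⟩ − ⟨h(x,y), h(x,y)⟩, equals K = κ_α g' / f at every point. -/

import Mathlib

open Matrix

noncomputable section

/-- The embedding of `ℝ³ = span{e₁,e₂,e₃}` into `ℝ⁴`. -/
def emb (p : Fin 3 → ℝ) : Fin 4 → ℝ := ![p 0, p 1, p 2, 0]

/-- The fourth standard basis vector `e₄` of `ℝ⁴`. -/
def e4 : Fin 4 → ℝ := ![0, 0, 0, 1]

/-- Model of the bivector `a ∧ b ∈ Λ²ℝ⁴` as the antisymmetric matrix `aᵢbⱼ − aⱼbᵢ`. -/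
def wedge (a b : Fin 4 → ℝ) : Fin 4 → Fin 4 → ℝ := fun i j => a i * b j - a j * b i

/-- The tangent `t = r'` of the spherical curve `r`. -/
def sphT (r : ℝ → Fin 3 → ℝ) : ℝ → Fin 3 → ℝ := deriv r

/-- The normal `n = r × t` of the spherical curve `r`. -/
def sphN (r : ℝ → Fin 3 → ℝ) (v : ℝ) : Fin 3 → ℝ := crossProduct (r v) (deriv r v)

/-- The spherical curvature `κ = ⟨t', n⟩` of the spherical curve `r`. -/
def sphCurv (r : ℝ → Fin 3 → ℝ) (v : ℝ) : ℝ := deriv (deriv r) v ⬝ᵥ sphN r v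

/-- The curvature `κ_α = f′g″ − g′f″` of the meridian curve `α = (f, g)`. -/
def merCurv (f g : ℝ → ℝ) (u : ℝ) : ℝ :=
  deriv f u * deriv (deriv g) u - deriv g u * deriv (deriv f) u

/-- The parametrization `z(u,v) = f(u) r(v) + g(u) e₄` of the meridian surface `M²`. -/
def mz (f g : ℝ → ℝ) (r : ℝ → Fin 3 → ℝ) (u v : ℝ) : Fin 4 → ℝ :=
  f u • emb (r v) + g u • e4

/-- The tangent frame vector `x = ∂z/∂u = f′ r + g′ e₄`. -/
def mx (f g : ℝ → ℝ) (r : ℝ → Fin 3 → ℝ) (u v : ℝ) : Fin 4 → ℝ :=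
  deriv f u • emb (r v) + deriv g u • e4

/-- The tangent frame vector `y = (1/f) ∂z/∂v = t`. -/
def my (r : ℝ → Fin 3 → ℝ) (v : ℝ) : Fin 4 → ℝ := emb (deriv r v)

/-- The normal frame vector `n₁ = n`. -/
def mn1 (r : ℝ → Fin 3 → ℝ) (v : ℝ) : Fin 4 → ℝ := emb (sphN r v)

/-- The normal frame vector `n₂ = −g′ r + f′ e₄`. -/
def mn2 (f g : ℝ → ℝ) (r : ℝ → Fin 3 → ℝ) (u v : ℝ) : Fin 4 → ℝ :=
  (-(deriv g u)) • emb (r v) + deriv f u • e4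

/-- The Gauss map `G = x ∧ y` of the meridian surface, with values in `Λ²ℝ⁴`. -/
def gaussG (f g : ℝ → ℝ) (r : ℝ → Fin 3 → ℝ) (u v : ℝ) : Fin 4 → Fin 4 → ℝ :=
  wedge (mx f g r u v) (my r v)

/-- The Laplacian `Δφ = −(∂²φ/∂u² + (1/f²) ∂²φ/∂v² + (f′/f) ∂φ/∂u)` of the meridian
surface, acting on `Λ²ℝ⁴`-valued functions. -/
def surfLap (f : ℝ → ℝ) (φ : ℝ → ℝ → Fin 4 → Fin 4 → ℝ) (u v : ℝ) : Fin 4 → Fin 4 → ℝ :=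
  -(deriv (deriv (fun s => φ s v)) u + (1 / f u ^ 2) • deriv (deriv (fun s => φ u s)) v
    + (deriv f u / f u) • deriv (fun s => φ s v) u)

/-- `h(x,x)`: the normal component (w.r.t. `{n₁, n₂}`) of `∇′ₓx = ∂x/∂u`. -/
def hxx (f g : ℝ → ℝ) (r : ℝ → Fin 3 → ℝ) (u v : ℝ) : Fin 4 → ℝ :=
  (deriv (fun s => mx f g r s v) u ⬝ᵥ mn1 r v) • mn1 r v
    + (deriv (fun s => mx f g r s v) u ⬝ᵥ mn2 f g r u v) • mn2 f g r u v

/-- `h(x,y)`: the normal component (w.r.t. `{n₁, n₂}`) of `∇′_y x = (1/f) ∂x/∂v`. -/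
def hxy (f g : ℝ → ℝ) (r : ℝ → Fin 3 → ℝ) (u v : ℝ) : Fin 4 → ℝ :=
  (((1 / f u) • deriv (fun s => mx f g r u s) v) ⬝ᵥ mn1 r v) • mn1 r v
    + (((1 / f u) • deriv (fun s => mx f g r u s) v) ⬝ᵥ mn2 f g r u v) • mn2 f g r u v

/-- `h(y,y)`: the normal component (w.r.t. `{n₁, n₂}`) of `∇′_y y = (1/f) ∂y/∂v`. -/
def hyy (f g : ℝ → ℝ) (r : ℝ → Fin 3 → ℝ) (u v : ℝ) : Fin 4 → ℝ :=
  (((1 / f u) • deriv (my r) v) ⬝ᵥ mn1 r v) • mn1 r v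
    + (((1 / f u) • deriv (my r) v) ⬝ᵥ mn2 f g r u v) • mn2 f g r u v


theorem emb_dotProduct_emb (a b : Fin 3 → ℝ) : emb a ⬝ᵥ emb b = a ⬝ᵥ b := by
  simp [emb, dotProduct, Fin.sum_univ_succ]

theorem emb_dotProduct_e4 (a : Fin 3 → ℝ) : emb a ⬝ᵥ e4 = 0 := by
  simp [emb, e4, dotProduct, Fin.sum_univ_succ]

theorem e4_dotProduct_emb (a : Fin 3 → ℝ) : e4 ⬝ᵥ emb a = 0 := by
  rw [dotProduct_comm, emb_dotProduct_e4]

theorem e4_dotProduct_e4 : e4 ⬝ᵥ e4 = 1 := by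
  simp [e4, dotProduct, Fin.sum_univ_succ]

theorem HasDerivAt.emb {c : ℝ → Fin 3 → ℝ} {c' : Fin 3 → ℝ} {v : ℝ} (h : HasDerivAt c c' v) :
    HasDerivAt (fun s => _root_.emb (c s)) (_root_.emb c') v := by
  rw [hasDerivAt_pi] at h ⊢
  intro i
  fin_cases i
  · exact h 0
  · exact h 1
  · exact h 2
  · exact hasDerivAt_const v 0

theorem HasDerivAt.dotProduct {n : Type*} [Fintype n] {a b : ℝ → n → ℝ} {a' b' : n → ℝ} {v : ℝ}
    (ha : HasDerivAt a a' v) (hb : HasDerivAt b b' v) :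
    HasDerivAt (fun s => a s ⬝ᵥ b s) (a' ⬝ᵥ b v + a v ⬝ᵥ b') v := by
  rw [hasDerivAt_pi] at ha hb
  simp only [_root_.dotProduct, ← Finset.sum_add_distrib]
  exact HasDerivAt.fun_sum fun i _ => (ha i).mul (hb i)

theorem ContDiffOn.hasDerivAt_deriv {E : Type*} [NormedAddCommGroup E] [NormedSpace ℝ E]
    {c : ℝ → E} {s : Set ℝ} (hs : IsOpen s) (hc : ContDiffOn ℝ (⊤ : ℕ∞) c s) {v : ℝ} (hv : v ∈ s) :
    HasDerivAt c (deriv c v) v :=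
  ((hc.differentiableOn (by simp)).differentiableAt (hs.mem_nhds hv)).hasDerivAt

theorem ContDiffOn.hasDerivAt_deriv_deriv {E : Type*} [NormedAddCommGroup E] [NormedSpace ℝ E]
    {c : ℝ → E} {s : Set ℝ} (hs : IsOpen s) (hc : ContDiffOn ℝ (⊤ : ℕ∞) c s) {v : ℝ} (hv : v ∈ s) :
    HasDerivAt (deriv c) (deriv (deriv c) v) v :=
  (hc.deriv_of_isOpen (m := (⊤ : ℕ∞)) hs (by simp)).hasDerivAt_deriv hs hv

/-- A curve on the unit sphere is orthogonal to its velocity. -/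
theorem dotProduct_deriv_eq_zero_of_unit {r : ℝ → Fin 3 → ℝ} {J : Set ℝ} (hJ : IsOpen J)
    (hr : ContDiffOn ℝ (⊤ : ℕ∞) r J) (hrs : ∀ v ∈ J, r v ⬝ᵥ r v = 1) {v : ℝ} (hv : v ∈ J) :
    r v ⬝ᵥ deriv r v = 0 := by
  have hd := hr.hasDerivAt_deriv hJ hv
  have hconst : HasDerivAt (fun s => r s ⬝ᵥ r s) 0 v :=
    (hasDerivAt_const v (1 : ℝ)).congr_of_eventuallyEq
      (Filter.eventually_of_mem (hJ.mem_nhds hv) hrs)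
  have h := (hd.dotProduct hd).unique hconst
  rw [dotProduct_comm (deriv r v)] at h
  linarith

/-- The acceleration of a unit speed curve on the unit sphere has radial component `-1`. -/
theorem dotProduct_deriv_deriv_eq_neg_one {r : ℝ → Fin 3 → ℝ} {J : Set ℝ} (hJ : IsOpen J)
    (hr : ContDiffOn ℝ (⊤ : ℕ∞) r J) (hrs : ∀ v ∈ J, r v ⬝ᵥ r v = 1)
    (hra : ∀ v ∈ J, deriv r v ⬝ᵥ deriv r v = 1) {v : ℝ} (hv : v ∈ J) :
    deriv (deriv r) v ⬝ᵥ r v = -1 := by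
  have hconst : HasDerivAt (fun s => r s ⬝ᵥ deriv r s) 0 v :=
    (hasDerivAt_const v (0 : ℝ)).congr_of_eventuallyEq
      (Filter.eventually_of_mem (hJ.mem_nhds hv)
        fun _ hs => dotProduct_deriv_eq_zero_of_unit hJ hr hrs hs)
  have h := ((hr.hasDerivAt_deriv hJ hv).dotProduct
    (hr.hasDerivAt_deriv_deriv hJ hv)).unique hconst
  rw [hra v hv] at h
  rw [dotProduct_comm]
  linarith

/-- The Gauss curvature `K = ⟨h(x,x), h(y,y)⟩ − ⟨h(x,y), h(x,y)⟩` of the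
meridian surface equals `K = κ_α g′ / f`. -/
theorem meridian_surface_gauss_curvature
    (I J : Set ℝ) (hI : IsOpen I) (hIiv : I.OrdConnected) (hIne : I.Nonempty)
    (hJ : IsOpen J) (hJiv : J.OrdConnected) (hJne : J.Nonempty)
    (r : ℝ → Fin 3 → ℝ) (hr : ContDiffOn ℝ (⊤ : ℕ∞) r J)
    (hrs : ∀ v ∈ J, r v ⬝ᵥ r v = 1) (hra : ∀ v ∈ J, deriv r v ⬝ᵥ deriv r v = 1)
    (f g : ℝ → ℝ) (hf : ContDiffOn ℝ (⊤ : ℕ∞) f I) (hg : ContDiffOn ℝ (⊤ : ℕ∞) g I)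
    (hf0 : ∀ u ∈ I, f u ≠ 0) (hfg : ∀ u ∈ I, deriv f u ^ 2 + deriv g u ^ 2 = 1) :
    ∀ u ∈ I, ∀ v ∈ J,
      hxx f g r u v ⬝ᵥ hyy f g r u v - hxy f g r u v ⬝ᵥ hxy f g r u v
        = merCurv f g u * deriv g u / f u := by
  intro u hu v hv
  have hxu : deriv (fun s => mx f g r s v) u
      = deriv (deriv f) u • emb (r v) + deriv (deriv g) u • e4 :=
    (((hf.hasDerivAt_deriv_deriv hI hu).smul_const (emb (r v))).add
      ((hg.hasDerivAt_deriv_deriv hI hu).smul_const e4)).deriv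
  have hxv : deriv (fun s => mx f g r u s) v = deriv f u • emb (deriv r v) :=
    (((hr.hasDerivAt_deriv hJ hv).emb.const_smul (deriv f u)).add_const _).deriv
  have hyv : deriv (my r) v = emb (deriv (deriv r) v) :=
    (hr.hasDerivAt_deriv_deriv hJ hv).emb.deriv
  have hrr := hrs v hv
  have hrt := dotProduct_deriv_eq_zero_of_unit hJ hr hrs hv
  have htr : deriv r v ⬝ᵥ r v = 0 := by rw [dotProduct_comm, hrt]
  have hrn : r v ⬝ᵥ sphN r v = 0 := dot_self_cross _ _
  have hnr : sphN r v ⬝ᵥ r v = 0 := by rw [dotProduct_comm, hrn]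
  have htn : deriv r v ⬝ᵥ sphN r v = 0 := dot_cross_self _ _
  have har := dotProduct_deriv_deriv_eq_neg_one hJ hr hrs hra hv
  have hfg' := hfg u hu
  simp only [hxx, hxy, hyy, hxu, hxv, hyv, mn1, mn2, merCurv, add_dotProduct, dotProduct_add,
    smul_dotProduct, dotProduct_smul, emb_dotProduct_emb, emb_dotProduct_e4, e4_dotProduct_emb,
    e4_dotProduct_e4, hrr, htr, hrn, hnr, htn, har, smul_eq_mul]
  linear_combination (deriv f u * deriv (deriv g) u - deriv g u * deriv (deriv f) u)
    * deriv g u / f u * hfg'
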